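/- arXiv:2508.08753 — 7 statements merged into one kernel-verified Lean document; each statement's English description precedes it below -/
import Mathlib

section
/- Let R be a local ring (not necessarily Noetherian) with maximal ideal M and residue field k = R/M, and assume R is complete with respect to the M-adic topology (i.e., the natural ring map R → lim_{n} R/M^n is an isomorphism). Then the natural surjective ring map R → k admits a ring-homomorphism section (i.e., there is a ring homomorphism g : k → R whose composition with the residue map is the identity of k) if and only if char(R) = char(k). -/
open Polynomial

/-- A subring of `k × B` that projects injectively to the field `k`, with image containing
all `p`-th powers for some `p > 0`, is a field. -/
lemma Subring.isField_of_injOn_fst {k B : Type*} [Field k] [CommRing B] {p : ℕ} (hp : 0 < p)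
    {S : Subring (k × B)} (hS : ∀ x ∈ S, x.1 = 0 → x = 0)
    (hpow : ∀ a : k, ∃ b, (a ^ p, b) ∈ S) : IsField S where
  exists_pair_ne := ⟨0, 1, fun h ↦ zero_ne_one (congr_arg (fun x : S ↦ x.1.1) h)⟩
  mul_comm := mul_comm
  mul_inv_cancel {x} hx := by
    have hx' : x.1.1 ≠ 0 := fun h ↦ hx (Subtype.ext (hS _ x.2 h))
    obtain ⟨b, hb⟩ := hpow x.1.1⁻¹
    refine ⟨x ^ (p - 1) * ⟨_, hb⟩, Subtype.ext (sub_eq_zero.mp (hS _ ?_ ?_))⟩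
    · exact S.sub_mem (SetLike.coe_mem _) S.one_mem
    · obtain ⟨n, rfl⟩ := Nat.exists_eq_add_of_lt hp
      simp only [zero_add, Nat.add_sub_cancel, Subring.coe_mul, SubmonoidClass.coe_pow,
        Prod.fst_sub, Prod.fst_mul, Prod.pow_fst, Subring.coe_one, Prod.fst_one]
      rw [← mul_assoc, ← pow_succ', ← mul_pow, mul_inv_cancel₀ hx', one_pow, sub_self]

/-- Adjoining a `p`-th root of an element to a subring of `k × B` as in
`Subring.isField_of_injOn_fst` preserves injectivity of the projection to `k`, provided that the
first coordinate of the root is new. -/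
lemma Subring.eq_zero_of_eval₂_fst_eq_zero {k B : Type*} [Field k] [CommRing B] {p : ℕ}
    [Fact p.Prime] [CharP k p] {S : Subring (k × B)} (hS : ∀ x ∈ S, x.1 = 0 → x = 0)
    (hpow : ∀ a : k, ∃ b, (a ^ p, b) ∈ S) {z : k × B} (hz : z ^ p ∈ S)
    (hz' : ∀ b, (z.1, b) ∉ S) (P : S[X]) (hP : (P.eval₂ S.subtype z).1 = 0) :
    P.eval₂ S.subtype z = 0 := by
  have hp : p.Prime := Fact.out
  let _ : Field S := (Subring.isField_of_injOn_fst hp.pos hS hpow).toField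
  let Q : S[X] := X ^ p - C ⟨z ^ p, hz⟩
  have hQ : Q.eval₂ S.subtype z = 0 := by simp [Q]
  have hirr : Irreducible Q := by
    refine X_pow_sub_C_irreducible_of_prime hp fun y hy ↦ hz' y.1.2 ?_
    have h : y.1.1 ^ p = z.1 ^ p := congr_arg (fun x : S ↦ x.1.1) hy
    rw [← frobenius_inj k p h]
    exact y.2
  by_cases hdvd : Q ∣ P
  · obtain ⟨R, rfl⟩ := hdvd
    rw [eval₂_mul, hQ, zero_mul]
  · obtain ⟨u, v, huv⟩ := (hirr.coprime_iff_not_dvd).mpr hdvd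
    have := congr_arg (fun P : S[X] ↦ (P.eval₂ S.subtype z).1) huv
    simp [eval₂_add, eval₂_mul, hQ, hP] at this

/-- A subring of `k × B` surjecting onto the field `k` of characteristic `p` contains the graph of a
ring homomorphism if the elements of the kernel have vanishing `p`-th power. -/
lemma Subring.exists_ringHom_graph_le {k B : Type*} [Field k] [CommRing B] (p : ℕ)
    [Fact p.Prime] [CharP k p] [CharP B p] (T : Subring (k × B))
    (hT : ∀ a, ∃ b, (a, b) ∈ T) (hker : ∀ b, (0, b) ∈ T → b ^ p = 0) :
    ∃ g : k →+* B, ∀ a, (a, g a) ∈ T := by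
  have hp : p.Prime := Fact.out
  let T₀ : Subring (k × B) := T.map (frobenius (k × B) p)
  have hT₀ : T₀ ≤ T := by
    rintro _ ⟨x, hx, rfl⟩
    exact T.pow_mem hx p
  let A : Set (Subring (k × B)) := {S | S ≤ T ∧ T₀ ≤ S ∧ ∀ x ∈ S, x.1 = 0 → x = 0}
  have hA₀ : T₀ ∈ A := by
    refine ⟨hT₀, le_rfl, ?_⟩
    rintro _ ⟨⟨a, b⟩, hx, rfl⟩ h0
    obtain rfl : a = 0 := eq_zero_of_pow_eq_zero (n := p) h0
    exact Prod.ext h0 (hker b hx)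
  obtain ⟨S, -, hmax⟩ := zorn_le_nonempty₀ A (fun c hcA hc S₀ hS₀ ↦ by
    have hmem {x} : x ∈ sSup c ↔ ∃ s ∈ c, x ∈ s :=
      Subring.mem_sSup_of_directedOn ⟨S₀, hS₀⟩ hc.directedOn
    refine ⟨sSup c, ⟨sSup_le fun s hs ↦ (hcA hs).1, (hcA hS₀).2.1.trans (le_sSup hS₀), ?_⟩,
      fun s hs ↦ le_sSup hs⟩
    intro x hx
    obtain ⟨s, hs, hxs⟩ := hmem.mp hx
    exact (hcA hs).2.2 x hxs) T₀ hA₀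
  obtain ⟨hST, hTS, hS⟩ := hmax.prop
  have hpow (a : k) : ∃ b, (a ^ p, b) ∈ S :=
    let ⟨b, hb⟩ := hT a
    ⟨b ^ p, hTS ⟨(a, b), hb, rfl⟩⟩
  have hsurj : ∀ a, ∃ b, (a, b) ∈ S := by
    intro a
    by_contra! ha
    obtain ⟨b, hb⟩ := hT a
    let S' : Subring (k × B) := (eval₂RingHom S.subtype (a, b)).range
    have hSS' : S ≤ S' := fun x hx ↦ ⟨C ⟨x, hx⟩, by simp⟩
    have hS' : S' ∈ A := by
      refine ⟨?_, hTS.trans hSS', ?_⟩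
      · rintro _ ⟨P, rfl⟩
        rw [coe_eval₂RingHom, eval₂_eq_sum_range]
        exact T.sum_mem fun i _ ↦ T.mul_mem (hST (P.coeff i).2) (T.pow_mem hb i)
      · rintro _ ⟨P, rfl⟩ h
        exact Subring.eq_zero_of_eval₂_fst_eq_zero hS hpow (hTS ⟨(a, b), hb, rfl⟩) ha P h
    exact ha b (hmax.le_of_ge hS' hSS' ⟨X, by simp⟩)
  let e : S ≃+* k := RingEquiv.ofBijective ((RingHom.fst k B).comp S.subtype)
    ⟨(injective_iff_map_eq_zero _).mpr fun x hx ↦ Subtype.ext (hS x x.2 hx),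
      fun a ↦ let ⟨b, hb⟩ := hsurj a; ⟨⟨_, hb⟩, rfl⟩⟩
  refine ⟨((RingHom.snd k B).comp S.subtype).comp e.symm, fun a ↦ hST ?_⟩
  have h : (e.symm a).1.1 = a := e.apply_symm_apply a
  have hmem := (e.symm a).2
  rwa [← Prod.mk.eta (p := (e.symm a).1), h] at hmem

/-- Every field of characteristic `p` is formally smooth over its prime field. -/
lemma Algebra.FormallySmooth.zmod (p : ℕ) [Fact p.Prime] (k : Type*) [Field k]
    [Algebra (ZMod p) k] : Algebra.FormallySmooth (ZMod p) k := by
  refine .of_comp_surjective fun B _ _ I hI f ↦ ?_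
  cases subsingleton_or_nontrivial B
  · exact ⟨default, AlgHom.ext fun x ↦ have := (Ideal.Quotient.mk_surjective (I := I)).subsingleton
      Subsingleton.elim _ _⟩
  have : CharP k p := charP_of_injective_algebraMap (algebraMap (ZMod p) k).injective p
  have : CharP B p := charP_of_injective_algebraMap (algebraMap (ZMod p) B).injective p
  obtain ⟨g, hg⟩ := Subring.exists_ringHom_graph_le p
    (RingHom.eqLocus ((f : k →+* B ⧸ I).comp (RingHom.fst k B))
      ((Ideal.Quotient.mk I).comp (RingHom.snd k B)))
    (fun a ↦ let ⟨b, hb⟩ := Ideal.Quotient.mk_surjective (f a); ⟨b, hb.symm⟩)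
    (fun b hb ↦ by
      have hbI : b ∈ I := Ideal.Quotient.eq_zero_iff_mem.mp (hb.symm.trans (map_zero f))
      have h2 : b ^ 2 ∈ I ^ 2 := Ideal.pow_mem_pow hbI 2
      rw [hI, Ideal.mem_bot] at h2
      exact pow_eq_zero_of_le (Fact.out : p.Prime).two_le h2)
  exact ⟨{ g with commutes' := fun x ↦
      congr($(Subsingleton.elim (g.comp (algebraMap (ZMod p) k)) (algebraMap (ZMod p) B)) x) },
    AlgHom.ext fun a ↦ (hg a).symm⟩

/-- Every field extension in characteristic zero is formally smooth. -/
lemma Algebra.FormallySmooth.of_charZero (F k : Type*) [Field F] [CharZero F] [Field k]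
    [Algebra F k] : Algebra.FormallySmooth F k := by
  obtain ⟨ι, v, hv⟩ := exists_isTranscendenceBasis' F k
  have := hv.isAlgebraic_field
  exact .of_algebraicIndependent_of_isSeparable hv.1

/-- The residue map of a complete local `F`-algebra has a section if the residue field is formally
smooth over `F`. -/
lemma IsLocalRing.exists_residue_comp_eq_id_of_formallySmooth (F R : Type*) [CommRing F]
    [CommRing R] [IsLocalRing R] [IsAdicComplete (maximalIdeal R) R] [Algebra F R]
    [Algebra.FormallySmooth F (ResidueField R)] :
    ∃ g : ResidueField R →+* R, (residue R).comp g = RingHom.id (ResidueField R) := by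
  obtain ⟨g, hg⟩ := Algebra.FormallySmooth.exists_mkₐ_comp_eq_of_isAdicComplete
    (I := maximalIdeal R) (AlgHom.id F (ResidueField R))
  exact ⟨g, RingHom.ext fun x ↦ congr($hg x)⟩

/-- A local ring with residue field of characteristic zero is a `ℚ`-algebra. -/
lemma IsLocalRing.nonempty_algebraRat (R : Type*) [CommRing R] [IsLocalRing R]
    [CharZero (ResidueField R)] : Nonempty (Algebra ℚ R) :=
  (EqualCharZero.nonempty_algebraRat_iff R).mpr fun _ hI ↦
    have : CharZero (R ⧸ maximalIdeal R) := inferInstanceAs (CharZero (ResidueField R))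
    (Ideal.Quotient.factor (le_maximalIdeal hI)).charZero


/-- Let `R` be a local ring (not necessarily Noetherian) with maximal ideal `M` and
residue field `k = R/M`, complete with respect to the `M`-adic topology. Then the
natural surjective ring map `R → k` admits a ring-homomorphism section iff
`char R = char k`. -/
theorem stmt_0 (R : Type*) [CommRing R] [IsLocalRing R]
    [IsAdicComplete (IsLocalRing.maximalIdeal R) R] :
    (∃ g : IsLocalRing.ResidueField R →+* R,
      (IsLocalRing.residue R).comp g = RingHom.id (IsLocalRing.ResidueField R)) ↔
    ringChar R = ringChar (IsLocalRing.ResidueField R) := by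
  constructor
  · rintro ⟨g, -⟩
    have := charP_of_injective_ringHom g.injective (ringChar (IsLocalRing.ResidueField R))
    exact ringChar.eq R _
  · intro h
    obtain hp | h0 := CharP.char_is_prime_or_zero (IsLocalRing.ResidueField R)
      (ringChar (IsLocalRing.ResidueField R))
    · have : Fact (ringChar (IsLocalRing.ResidueField R)).Prime := ⟨hp⟩
      let _ : Algebra (ZMod (ringChar (IsLocalRing.ResidueField R))) R :=
        ZMod.algebra' R (ringChar R) h.dvd
      have := Algebra.FormallySmooth.zmod (ringChar (IsLocalRing.ResidueField R))
        (IsLocalRing.ResidueField R)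
      exact IsLocalRing.exists_residue_comp_eq_id_of_formallySmooth
        (ZMod (ringChar (IsLocalRing.ResidueField R))) R
    · have : CharZero (IsLocalRing.ResidueField R) :=
        (CharP.ringChar_zero_iff_CharZero _).mp h0
      obtain ⟨_⟩ := IsLocalRing.nonempty_algebraRat R
      have := @Algebra.FormallySmooth.of_charZero ℚ (IsLocalRing.ResidueField R) _ _ _
        (IsLocalRing.ResidueField.algebra R)
      exact IsLocalRing.exists_residue_comp_eq_id_of_formallySmooth ℚ R
end

section
/- Let R be a local ring with maximal ideal M and residue field k = R/M, complete with respect to the M-adic topology, and suppose char(k) = p > 0 for a prime p. Then the natural surjective group homomorphism R* → k* between groups of units admits a group-homomorphism section (i.e., there is a group homomorphism s : k* → R* with (residue map) ∘ s = id on k*). -/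
/-- A commutative group of prime exponent is a vector space over `ZMod p`, so every subgroup has
a complement. -/
theorem AddSubgroup.exists_isCompl_of_prime_nsmul_eq_zero {A : Type*} [AddCommGroup A] {p : ℕ}
    (hp : p.Prime) (hA : ∀ x : A, p • x = 0) (V : AddSubgroup A) :
    ∃ W : AddSubgroup A, IsCompl V W := by
  have : Module (ZMod p) A := AddCommGroup.zmodModule hA
  let e : AddSubgroup A ≃o Submodule (ZMod p) A := AddSubgroup.toZModSubmodule p
  have := Fact.mk hp
  obtain ⟨W, hW⟩ := (e V).exists_isCompl
  exact ⟨e.symm W, e.isCompl_iff.2 (by rwa [e.apply_symm_apply])⟩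

theorem Subgroup.exists_isCompl_of_pow_prime_eq_one {Q : Type*} [CommGroup Q] {p : ℕ}
    (hp : p.Prime) (hQ : ∀ x : Q, x ^ p = 1) (V : Subgroup Q) : ∃ W : Subgroup Q, IsCompl V W := by
  obtain ⟨W, hW⟩ := AddSubgroup.exists_isCompl_of_prime_nsmul_eq_zero hp
    (A := Additive Q) hQ V.toAddSubgroup
  refine ⟨Subgroup.toAddSubgroup.symm W, Subgroup.toAddSubgroup.isCompl_iff.2 ?_⟩
  rwa [OrderIso.apply_symm_apply]

/-- If `K' ≤ K` are subgroups of a commutative group such that `G ⧸ K` has no `p`-torsion and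
`K ⧸ K'` has exponent `p`, then the extension `K ⧸ K' → G ⧸ K' → G ⧸ K` splits. -/
theorem Subgroup.exists_inf_eq_sup_eq_top {G : Type*} [CommGroup G] {p : ℕ} (hp : p.Prime)
    {K' K : Subgroup G} (hle : K' ≤ K) (htf : ∀ x, x ^ p ∈ K → x ∈ K)
    (hexp : ∀ x ∈ K, x ^ p ∈ K') :
    ∃ H : Subgroup G, H ⊓ K = K' ∧ H ⊔ K = ⊤ := by
  let P : Subgroup G := K' ⊔ (powMonoidHom p : G →* G).range
  have hKP : ∀ x ∈ K, x ∈ P → x ∈ K' := by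
    intro x hxK hxP
    obtain ⟨y, hy, _, ⟨z, rfl⟩, rfl⟩ := Subgroup.mem_sup.1 hxP
    exact K'.mul_mem hy (hexp z (htf z ((K.mul_mem_cancel_left (hle hy)).1 hxK)))
  have hQ : ∀ x : G ⧸ P, x ^ p = 1 := by
    intro x
    obtain ⟨g, rfl⟩ := QuotientGroup.mk_surjective x
    rw [← QuotientGroup.mk_pow, QuotientGroup.eq_one_iff]
    exact Subgroup.mem_sup_right ⟨g, rfl⟩
  obtain ⟨W, hW⟩ :=
    Subgroup.exists_isCompl_of_pow_prime_eq_one hp hQ (K.map (QuotientGroup.mk' P))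
  have hPH : P ≤ W.comap (QuotientGroup.mk' P) := fun x hx => by
    rw [Subgroup.mem_comap, QuotientGroup.mk'_apply, (QuotientGroup.eq_one_iff x).2 hx]
    exact W.one_mem
  refine ⟨W.comap (QuotientGroup.mk' P),
    le_antisymm ?_ (le_inf (le_sup_left.trans hPH) hle), eq_top_iff.2 ?_⟩
  · rintro x ⟨hxW, hxK⟩
    exact hKP x hxK ((QuotientGroup.eq_one_iff x).1
      (Subgroup.disjoint_def.1 hW.disjoint ⟨x, hxK, rfl⟩ hxW))
  · intro x _
    obtain ⟨_, ⟨y, hy, rfl⟩, w, hw, hyw⟩ :=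
      Subgroup.mem_sup.1 (hW.sup_eq_top ▸ Subgroup.mem_top (QuotientGroup.mk' P x))
    refine Subgroup.mem_sup.2 ⟨x / y, ?_, y, hy, by simp⟩
    rwa [Subgroup.mem_comap, map_div, ← hyw, mul_div_cancel_left]

/-- A version of `Subgroup.exists_inf_eq_sup_eq_top` inside a subgroup `H`. -/
theorem Subgroup.exists_inf_eq_sup_eq {G : Type*} [CommGroup G] {p : ℕ} (hp : p.Prime)
    {K' K H : Subgroup G} (hle : K' ≤ K) (hKH : K ≤ H) (htf : ∀ x ∈ H, x ^ p ∈ K → x ∈ K)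
    (hexp : ∀ x ∈ K, x ^ p ∈ K') :
    ∃ H' : Subgroup G, H' ⊓ K = K' ∧ H' ⊔ K = H := by
  obtain ⟨L, hinf, hsup⟩ := Subgroup.exists_inf_eq_sup_eq_top hp
    (K' := K'.subgroupOf H) (K := K.subgroupOf H) (fun x hx => hle hx)
    (fun x hx => htf x x.2 hx) (fun x hx => hexp x hx)
  refine ⟨L.map H.subtype, ?_, ?_⟩
  · have := congrArg (Subgroup.map H.subtype) hinf
    rwa [Subgroup.map_inf _ _ _ H.subtype_injective, Subgroup.map_subgroupOf_eq_of_le hKH,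
      Subgroup.map_subgroupOf_eq_of_le (hle.trans hKH)] at this
  · have := congrArg (Subgroup.map H.subtype) hsup
    rwa [Subgroup.map_sup, Subgroup.map_subgroupOf_eq_of_le hKH, ← MonoidHom.range_eq_map,
      Subgroup.range_subtype] at this

/-- The subgroup of units congruent to `1` modulo an ideal. -/
def Ideal.oneUnits {R : Type*} [CommRing R] (I : Ideal R) : Subgroup Rˣ :=
  (Units.map (Ideal.Quotient.mk I).toMonoidHom).ker

namespace Ideal

variable {R : Type*} [CommRing R]

theorem mem_oneUnits {I : Ideal R} {x : Rˣ} : x ∈ I.oneUnits ↔ (x : R) - 1 ∈ I := by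
  rw [oneUnits, MonoidHom.mem_ker, Units.ext_iff, ← Ideal.Quotient.eq]
  rfl

theorem div_mem_oneUnits {I : Ideal R} {x y : Rˣ} :
    x / y ∈ I.oneUnits ↔ (x : R) - y ∈ I := by
  rw [oneUnits, ← QuotientGroup.eq_iff_div_mem, ← Ideal.Quotient.eq,
    QuotientGroup.eq, MonoidHom.mem_ker, map_mul, map_inv, inv_mul_eq_one, Units.ext_iff]
  rfl

theorem oneUnits_mono {I J : Ideal R} (h : I ≤ J) : I.oneUnits ≤ J.oneUnits :=
  fun _ hx => mem_oneUnits.2 (h (mem_oneUnits.1 hx))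

theorem pow_mem_oneUnits_mul {I J : Ideal R} {p : ℕ} (hp : (p : R) ∈ J) (hIJ : I ≤ J)
    {x : Rˣ} (hx : x ∈ I.oneUnits) : x ^ p ∈ (I * J).oneUnits := by
  rw [mem_oneUnits] at hx ⊢
  rw [Units.val_pow_eq_pow_val, ← mul_geom_sum]
  refine Ideal.mul_mem_mul hx (Ideal.Quotient.eq_zero_iff_mem.1 ?_)
  have h1 : Ideal.Quotient.mk J (x : R) = 1 := Ideal.Quotient.eq.2 (hIJ hx)
  simpa [h1] using Ideal.Quotient.eq_zero_iff_mem.2 hp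

end Ideal

namespace IsLocalRing

variable {R : Type*} [CommRing R] [IsLocalRing R]

theorem mem_oneUnits_of_pow_char_mem {p : ℕ} (hp : p.Prime) [CharP (ResidueField R) p] {x : Rˣ}
    (hx : x ^ p ∈ (maximalIdeal R).oneUnits) : x ∈ (maximalIdeal R).oneUnits := by
  have := Fact.mk hp
  rw [Ideal.mem_oneUnits, ← residue_eq_zero_iff, map_sub, map_one] at hx ⊢
  rw [Units.val_pow_eq_pow_val, map_pow, ← one_pow p, ← sub_pow_char] at hx
  exact eq_zero_of_pow_eq_zero hx

open Ideal in
/-- Refine a partial lift of the residue units modulo `M ^ (n + 1)` to one modulo `M ^ (n + 2)`. -/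
theorem exists_le_inf_oneUnits_eq {p : ℕ} (hp : p.Prime) [CharP (ResidueField R) p] (n : ℕ)
    {H : Subgroup Rˣ} (hinf : H ⊓ (maximalIdeal R).oneUnits = (maximalIdeal R ^ (n + 1)).oneUnits)
    (hsup : H ⊔ (maximalIdeal R).oneUnits = ⊤) :
    ∃ H' ≤ H, H' ⊓ (maximalIdeal R).oneUnits = (maximalIdeal R ^ (n + 2)).oneUnits ∧
      H' ⊔ (maximalIdeal R).oneUnits = ⊤ := by
  have hpM : (p : R) ∈ maximalIdeal R := by
    rw [← residue_eq_zero_iff, map_natCast, CharP.cast_eq_zero]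
  have hM : maximalIdeal R ^ (n + 1) ≤ maximalIdeal R := Ideal.pow_le_self n.succ_ne_zero
  obtain ⟨H', h1, h2⟩ := Subgroup.exists_inf_eq_sup_eq hp
    (K' := (maximalIdeal R ^ (n + 2)).oneUnits) (K := (maximalIdeal R ^ (n + 1)).oneUnits)
    (H := H) (oneUnits_mono (Ideal.pow_le_pow_right (by lia))) (hinf ▸ inf_le_left)
    (fun x hx hxp => hinf ▸ ⟨hx, mem_oneUnits_of_pow_char_mem hp (oneUnits_mono hM hxp)⟩)
    (fun x hx => pow_succ (maximalIdeal R) (n + 1) ▸ pow_mem_oneUnits_mul hpM hM hx)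
  have hle : H' ≤ H := h2 ▸ le_sup_left
  refine ⟨H', hle, ?_, ?_⟩
  · rw [← h1, ← hinf, ← inf_assoc, inf_eq_left.2 hle]
  · rw [← hsup, ← h2, sup_assoc, sup_eq_right.2 (oneUnits_mono hM)]

open Ideal in
theorem exists_antitone_inf_oneUnits_eq {p : ℕ} (hp : p.Prime) [CharP (ResidueField R) p] :
    ∃ H : ℕ → Subgroup Rˣ, Antitone H ∧
      (∀ n, H n ⊓ (maximalIdeal R).oneUnits = (maximalIdeal R ^ (n + 1)).oneUnits) ∧
      ∀ n, H n ⊔ (maximalIdeal R).oneUnits = ⊤ := by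
  choose! next hle hinf hsup using fun n (H : Subgroup Rˣ)
    (h : H ⊓ (maximalIdeal R).oneUnits = (maximalIdeal R ^ (n + 1)).oneUnits ∧
      H ⊔ (maximalIdeal R).oneUnits = ⊤) => exists_le_inf_oneUnits_eq hp n h.1 h.2
  let H : ℕ → Subgroup Rˣ := fun n => Nat.rec ⊤ next n
  have hH : ∀ n, H n ⊓ (maximalIdeal R).oneUnits = (maximalIdeal R ^ (n + 1)).oneUnits ∧
      H n ⊔ (maximalIdeal R).oneUnits = ⊤ := by
    intro n
    induction n with
    | zero => simp [H]
    | succ n ih => exact ⟨hinf n _ ih, hsup n _ ih⟩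
  exact ⟨H, antitone_nat_of_succ_le fun n => hle n _ (hH n), fun n => (hH n).1, fun n => (hH n).2⟩

open Ideal in
/-- The units of the residue field of a complete local ring of positive residue characteristic
lift to a complement of the group of one-units. -/
theorem exists_isCompl_oneUnits [IsAdicComplete (maximalIdeal R) R] {p : ℕ} (hp : p.Prime)
    [CharP (ResidueField R) p] :
    ∃ H : Subgroup Rˣ, IsCompl H (maximalIdeal R).oneUnits := by
  obtain ⟨H, hanti, hinf, hsup⟩ := exists_antitone_inf_oneUnits_eq (R := R) hp
  refine ⟨⨅ n, H n, Subgroup.disjoint_def.2 fun {x} hx hxM => ?_,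
    codisjoint_iff.2 (eq_top_iff.2 fun x _ => ?_)⟩
  · rw [Units.ext_iff, ← sub_eq_zero]
    refine IsHausdorff.haus (I := maximalIdeal R) inferInstance _ fun n => ?_
    rw [SModEq.zero, smul_eq_mul, mul_top]
    have : x ∈ (maximalIdeal R ^ (n + 1)).oneUnits :=
      hinf n ▸ ⟨(Subgroup.mem_iInf.1 hx) n, hxM⟩
    exact Ideal.pow_le_pow_right n.le_succ (mem_oneUnits.1 this)
  · have hlift : ∀ n, ∃ h ∈ H n, h / x ∈ (maximalIdeal R).oneUnits := by
      intro n
      obtain ⟨h, hh, m, hm, rfl⟩ := Subgroup.mem_sup.1 (hsup n ▸ Subgroup.mem_top x)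
      exact ⟨h, hh, by simpa using hm⟩
    choose h hh hhx using hlift
    obtain ⟨L, hL⟩ := IsPrecomplete.prec (I := maximalIdeal R) (M := R) inferInstance
      (f := fun n => (h n : R)) fun {m n} hmn => by
        rw [SModEq.sub_mem, smul_eq_mul, mul_top]
        have : h m / h n ∈ (maximalIdeal R ^ (m + 1)).oneUnits := by
          rw [← hinf m]
          refine ⟨(H m).div_mem (hh m) (hanti hmn (hh n)), ?_⟩
          simpa using (maximalIdeal R).oneUnits.div_mem (hhx m) (hhx n)
        exact Ideal.pow_le_pow_right m.le_succ (div_mem_oneUnits.1 this)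
    simp only [SModEq.sub_mem, smul_eq_mul, mul_top] at hL
    have hLu : IsUnit L := by
      by_contra hLM
      have := (maximalIdeal R).add_mem (by simpa using hL 1) ((mem_maximalIdeal L).2 hLM)
      simp at this
    obtain ⟨u, rfl⟩ := hLu
    have hu : ∀ n, h n / u ∈ (maximalIdeal R ^ n).oneUnits := fun n => div_mem_oneUnits.2 (hL n)
    refine Subgroup.mem_sup.2 ⟨u, Subgroup.mem_iInf.2 fun n => ?_, x / u, ?_, by simp⟩
    · have h1 : h (n + 1) / u ∈ H n :=
        (hinf n ▸ inf_le_left : (maximalIdeal R ^ (n + 1)).oneUnits ≤ H n) (hu (n + 1))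
      have h2 := (H n).div_mem (hanti n.le_succ (hh (n + 1))) h1
      simpa using h2
    · have h1 : h 1 / u ∈ (maximalIdeal R).oneUnits := by simpa using hu 1
      rw [← div_div_div_cancel_left u x (h 1)]
      exact (maximalIdeal R).oneUnits.div_mem h1 (hhx 1)

end IsLocalRing

/-- Let `R` be a complete local ring whose residue field `k` has prime characteristic
`p > 0`. Then the natural surjective group homomorphism `Rˣ → kˣ` admits a
group-homomorphism section. -/
theorem stmt_2 (R : Type*) [CommRing R] [IsLocalRing R]
    [IsAdicComplete (IsLocalRing.maximalIdeal R) R]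
    (p : ℕ) (hp : p.Prime) (hchar : ringChar (IsLocalRing.ResidueField R) = p) :
    ∃ s : (IsLocalRing.ResidueField R)ˣ →* Rˣ,
      (Units.map (IsLocalRing.residue R).toMonoidHom).comp s =
        MonoidHom.id (IsLocalRing.ResidueField R)ˣ := by
  have : CharP (IsLocalRing.ResidueField R) p := ringChar.of_eq hchar
  obtain ⟨H, hH⟩ := IsLocalRing.exists_isCompl_oneUnits (R := R) hp
  let f : Rˣ →* (IsLocalRing.ResidueField R)ˣ :=
    Units.map (IsLocalRing.residue R).toMonoidHom
  have hker : f.ker = (IsLocalRing.maximalIdeal R).oneUnits := rfl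
  have hbij : Function.Bijective (f.comp H.subtype) := by
    constructor
    · refine (injective_iff_map_eq_one _).2 fun x hx => Subtype.ext ?_
      exact Subgroup.disjoint_def.1 hH.disjoint x.2 (hker ▸ hx)
    · intro y
      obtain ⟨x, rfl⟩ := IsLocalRing.surjective_units_map_of_local_ringHom
        (IsLocalRing.residue R) IsLocalRing.residue_surjective inferInstance y
      obtain ⟨h, hh, m, hm, rfl⟩ := Subgroup.mem_sup.1 (hH.sup_eq_top ▸ Subgroup.mem_top x)
      refine ⟨⟨h, hh⟩, ?_⟩
      have hm1 : f m = 1 := hm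
      exact ((map_mul f h m).trans (by rw [hm1, mul_one]; rfl)).symm
  let e := MulEquiv.ofBijective _ hbij
  exact ⟨H.subtype.comp e.symm.toMonoidHom, MonoidHom.ext fun y => e.apply_symm_apply y⟩
end

section
/- Let R be a local ring with maximal ideal M and residue field k = R/M, complete with respect to the M-adic topology. Then the short exact sequence of abelian groups 1 → 1+M → R* → k* → 1 is split; in particular there is an isomorphism of abelian groups R* ≅ (1+M) × k*. -/
theorem AddMonoidHom.exists_leftInverse_of_zmodModule {V Q : Type*} [AddCommGroup V]
    [AddCommGroup Q] (p : ℕ) [Fact p.Prime] [Module (ZMod p) V] [Module (ZMod p) Q] (j : V →+ Q)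
    (hj : ∀ v, j v = 0 → v = 0) : ∃ l : Q →+ V, ∀ v, l (j v) = v := by
  obtain ⟨l, hl⟩ := (j.toZModLinearMap p).exists_leftInverse_of_injective
    (LinearMap.ker_eq_bot'.2 hj)
  exact ⟨l.toAddMonoidHom, fun v ↦ LinearMap.congr_fun hl v⟩

/-- An abelian group killed by a prime `p` and meeting `p • P` trivially is a direct summand
of `P`. -/
theorem AddMonoidHom.exists_leftInverse_of_nsmul_eq_zero {V P : Type*} [AddCommGroup V]
    [AddCommGroup P] (p : ℕ) [Fact p.Prime] (hV : ∀ v : V, p • v = 0) (i : V →+ P)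
    (hi : ∀ x v, p • x = i v → v = 0) : ∃ r : P →+ V, ∀ v, r (i v) = v := by
  let H : AddSubgroup P := (nsmulAddMonoidHom (α := P) p).range
  let _ : Module (ZMod p) V := AddCommGroup.zmodModule hV
  let _ : Module (ZMod p) (P ⧸ H) := QuotientAddGroup.zmodModule fun x ↦ ⟨x, rfl⟩
  obtain ⟨l, hl⟩ := exists_leftInverse_of_zmodModule p ((QuotientAddGroup.mk' H).comp i)
    fun v hv ↦ by
      obtain ⟨x, hx⟩ := (QuotientAddGroup.eq_zero_iff (N := H) (i v)).1 hv
      exact hi x v hx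
  exact ⟨l.comp (QuotientAddGroup.mk' H), hl⟩

/-- A divisible subgroup of an abelian group is a direct summand. -/
theorem AddMonoidHom.exists_leftInverse_of_divisible {V P : Type*} [AddCommGroup V]
    [AddCommGroup P] (hV : ∀ n : ℕ, n ≠ 0 → ∀ v : V, ∃ w, n • w = v) (i : V →+ P)
    (hi : Function.Injective i) : ∃ r : P →+ V, ∀ v, r (i v) = v := by
  let _ : DivisibleBy V ℕ := divisibleByOfSMulRightSurj V ℕ fun hn v ↦ hV _ hn v
  let _ : DivisibleBy V ℤ := AddGroup.divisibleByIntOfDivisibleByNat V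
  obtain ⟨r, hr⟩ := (Module.Baer.of_divisible V).extension_property_addMonoidHom i hi
    (AddMonoidHom.id V)
  exact ⟨r, fun v ↦ DFunLike.congr_fun hr v⟩

/-- A homomorphism `g : A →+ B` lifts along a surjection `f : E →+ B` as soon as the kernel of
`f` is a direct summand of the pullback of `f` and `g`. -/
theorem AddMonoidHom.exists_lift_of_retraction {E A B : Type*} [AddCommGroup E] [AddCommGroup A]
    [AddCommGroup B] (f : E →+ B) (hf : Function.Surjective f) (g : A →+ B)
    (H : ∀ i : f.ker →+ (f.comp (fst E A)).eqLocus (g.comp (snd E A)),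
      (∀ v, (i v : E × A) = (↑v, 0)) → ∃ r : _ →+ f.ker, ∀ v, r (i v) = v) :
    ∃ h : A →+ E, f.comp h = g := by
  let P := (f.comp (fst E A)).eqLocus (g.comp (snd E A))
  let i : f.ker →+ P := ((inl E A).comp f.ker.subtype).codRestrict P fun v ↦ by
    have : f v = 0 := v.2
    change f v = g 0
    rw [this, map_zero]
  obtain ⟨r, hr⟩ := H i fun v ↦ rfl
  let π : P →+ A := (snd E A).comp P.subtype
  have hπ : Function.Surjective π := fun a ↦ by
    obtain ⟨e, he⟩ := hf (g a)
    exact ⟨⟨(e, a), he⟩, rfl⟩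
  let φ : P →+ E := (fst E A).comp P.subtype - f.ker.subtype.comp r
  have hφ : π.ker ≤ φ.ker := by
    rintro ⟨⟨e, a⟩, hea⟩ (ha : a = 0)
    subst ha
    have he : f e = 0 := Eq.trans hea (map_zero g)
    have := hr ⟨e, he⟩
    change e - (r ⟨(e, 0), hea⟩ : E) = 0
    have h2 : r ⟨(e, 0), hea⟩ = ⟨e, he⟩ := this
    rw [h2, sub_self]
  refine ⟨π.liftOfSurjective hπ ⟨φ, hφ⟩, ?_⟩
  ext a
  obtain ⟨⟨⟨e, a⟩, hea⟩, rfl⟩ := hπ a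
  have h1 : π.liftOfSurjective hπ ⟨φ, hφ⟩ (π ⟨(e, a), hea⟩) = φ ⟨(e, a), hea⟩ :=
    π.liftOfRightInverse_comp_apply _ _ _ _
  have h2 : f (r ⟨(e, a), hea⟩ : E) = 0 := (r ⟨(e, a), hea⟩).2
  rw [comp_apply, h1]
  change f (e - (r ⟨(e, a), hea⟩ : E)) = g a
  rw [map_sub, h2, sub_zero]
  exact hea

/-- Homomorphisms from an abelian group without `p`-torsion lift along surjections of abelian
groups whose kernel is killed by the prime `p`. -/
theorem MonoidHom.exists_lift_of_ker_pow_eq_one {E A B : Type*} [CommGroup E] [CommGroup A]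
    [CommGroup B] (p : ℕ) [Fact p.Prime] (hA : ∀ a : A, a ^ p = 1 → a = 1) (f : E →* B)
    (hf : Function.Surjective f) (hker : ∀ e, f e = 1 → e ^ p = 1) (g : A →* B) :
    ∃ h : A →* E, f.comp h = g := by
  obtain ⟨h, hh⟩ := AddMonoidHom.exists_lift_of_retraction (toAdditive f) hf (toAdditive g)
    fun i hi ↦ AddMonoidHom.exists_leftInverse_of_nsmul_eq_zero p
      (V := (toAdditive f).ker)
      (fun v ↦ Subtype.ext (hker v.1 v.2)) i (by
        rintro ⟨⟨e, a⟩, hea⟩ v hv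
        have h1 := congrArg Subtype.val hv
        rw [hi] at h1
        have ha : a = 0 := hA a (congrArg Prod.snd h1)
        subst ha
        have he : p • e = (v : Additive E) := congrArg Prod.fst h1
        refine Subtype.ext (he.symm.trans (hker e ?_))
        exact Eq.trans hea (map_one g))
  exact ⟨toAdditive.symm h, MonoidHom.ext fun a ↦ DFunLike.congr_fun hh a⟩

/-- Homomorphisms of abelian groups lift along surjections with divisible kernel. -/
theorem MonoidHom.exists_lift_of_ker_divisible {E A B : Type*} [CommGroup E] [CommGroup A]
    [CommGroup B] (f : E →* B) (hf : Function.Surjective f)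
    (hker : ∀ n : ℕ, n ≠ 0 → ∀ e, f e = 1 → ∃ w, f w = 1 ∧ w ^ n = e) (g : A →* B) :
    ∃ h : A →* E, f.comp h = g := by
  obtain ⟨h, hh⟩ := AddMonoidHom.exists_lift_of_retraction (toAdditive f) hf (toAdditive g)
    fun i hi ↦ AddMonoidHom.exists_leftInverse_of_divisible
      (fun n hn v ↦ by
        obtain ⟨w, hw, hwn⟩ := hker n hn v.1 v.2
        exact ⟨⟨w, hw⟩, Subtype.ext hwn⟩) i (fun v w hvw ↦ by
        have h1 := congrArg Subtype.val hvw
        rw [hi, hi] at h1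
        exact Subtype.ext (congrArg Prod.fst h1))
  exact ⟨toAdditive.symm h, MonoidHom.ext fun a ↦ DFunLike.congr_fun hh a⟩

theorem one_add_pow_of_mul_self_eq_zero {S : Type*} [CommRing S] {x : S} (hx : x * x = 0)
    (n : ℕ) : (1 + x) ^ n = 1 + n * x := by
  induction n with
  | zero => simp
  | succ n ih =>
    rw [pow_succ, ih]
    push_cast
    linear_combination (n : S) * hx

namespace IsLocalRing

variable {R : Type*} [CommRing R] [IsLocalRing R]

open Ideal.Quotient

theorem units_map_factorPow_surjective {n : ℕ} (hn : 0 < n) :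
    Function.Surjective (Units.map
      (factorPow (maximalIdeal R) (Nat.le_succ n)).toMonoidHom) := by
  intro u
  obtain ⟨a, ha⟩ := factor_surjective (Ideal.pow_le_pow_right n.le_succ) (u : R ⧸ maximalIdeal R ^ n)
  have : IsUnit a := factorPowSucc.isUnit_of_isUnit_image hn (by
    rw [show factorPow (maximalIdeal R) n.le_succ a = u from ha]; exact u.isUnit)
  exact ⟨this.unit, Units.ext ha⟩

theorem exists_eq_one_add_of_units_map_factorPow_eq_one {n : ℕ}
    {u : (R ⧸ maximalIdeal R ^ (n + 1))ˣ}
    (hu : Units.map (factorPow (maximalIdeal R) (Nat.le_succ n)).toMonoidHom u = 1) :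
    ∃ y ∈ maximalIdeal R ^ n, (u : R ⧸ maximalIdeal R ^ (n + 1)) = 1 + mk _ y := by
  obtain ⟨r, hr⟩ := mk_surjective (u : R ⧸ maximalIdeal R ^ (n + 1))
  refine ⟨r - 1, ?_, by simp [hr]⟩
  have h1 : factorPow (maximalIdeal R) (Nat.le_succ n) (u : R ⧸ maximalIdeal R ^ (n + 1)) = 1 :=
    congrArg Units.val hu
  rw [← hr] at h1
  exact Ideal.Quotient.eq.1 h1

theorem mk_mul_mk_eq_zero {n : ℕ} {x y : R} (hx : x ∈ maximalIdeal R)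
    (hy : y ∈ maximalIdeal R ^ n) :
    mk (maximalIdeal R ^ (n + 1)) x * mk (maximalIdeal R ^ (n + 1)) y = 0 := by
  rw [← map_mul, eq_zero_iff_mem, pow_succ']
  exact Ideal.mul_mem_mul hx hy

/-- Homomorphisms from the units of the residue field into the units of `R ⧸ M ^ n` lift to
`R ⧸ M ^ (n + 1)`. -/
theorem exists_units_lift_factorPow {n : ℕ} (hn : 0 < n)
    (s : (ResidueField R)ˣ →* (R ⧸ maximalIdeal R ^ n)ˣ) :
    ∃ t : (ResidueField R)ˣ →* (R ⧸ maximalIdeal R ^ (n + 1))ˣ,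
      (Units.map (factorPow (maximalIdeal R) (Nat.le_succ n)).toMonoidHom).comp t = s := by
  have hle : maximalIdeal R ^ n ≤ maximalIdeal R := Ideal.pow_le_self hn.ne'
  obtain ⟨p, hp⟩ := CharP.exists (ResidueField R)
  rcases CharP.char_is_prime_or_zero (ResidueField R) p with hp' | rfl
  · have : Fact p.Prime := ⟨hp'⟩
    refine MonoidHom.exists_lift_of_ker_pow_eq_one p (fun a ha ↦ ?_) _
      (units_map_factorPow_surjective hn) (fun u hu ↦ ?_) s
    · refine Units.ext (frobenius_inj (ResidueField R) p ?_)
      simpa [frobenius_def] using congrArg Units.val ha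
    · obtain ⟨y, hy, hu⟩ := exists_eq_one_add_of_units_map_factorPow_eq_one hu
      have hpM : (p : R) ∈ maximalIdeal R := by
        rw [← residue_eq_zero_iff, map_natCast, CharP.cast_eq_zero]
      refine Units.ext ?_
      rw [Units.val_pow_eq_pow_val, hu,
        one_add_pow_of_mul_self_eq_zero (mk_mul_mk_eq_zero (hle hy) hy),
        ← map_natCast (mk (maximalIdeal R ^ (n + 1))) p, mk_mul_mk_eq_zero hpM hy, add_zero,
        Units.val_one]
  · refine MonoidHom.exists_lift_of_ker_divisible _ (units_map_factorPow_surjective hn)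
      (fun m hm u hu ↦ ?_) s
    obtain ⟨y, hy, hu⟩ := exists_eq_one_add_of_units_map_factorPow_eq_one hu
    have := CharP.charP_to_charZero (ResidueField R)
    have hmu : IsUnit (m : R) := by
      rw [← residue_ne_zero_iff_isUnit, map_natCast]
      exact Nat.cast_ne_zero.2 hm
    obtain ⟨c, hc⟩ := hmu.exists_right_inv
    have hcy : c * y ∈ maximalIdeal R ^ n := Ideal.mul_mem_left _ _ hy
    have hpow : (1 + mk (maximalIdeal R ^ (n + 1)) (c * y)) ^ m = u := by
      rw [one_add_pow_of_mul_self_eq_zero (mk_mul_mk_eq_zero (hle hcy) hcy), hu,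
        ← map_natCast (mk (maximalIdeal R ^ (n + 1))) m, ← map_mul, ← mul_assoc, hc, one_mul]
    have hw : IsUnit (1 + mk (maximalIdeal R ^ (n + 1)) (c * y)) :=
      (isUnit_pow_iff hm).1 (hpow ▸ u.isUnit)
    refine ⟨hw.unit, Units.ext ?_, Units.ext hpow⟩
    have : factorPow (maximalIdeal R) (Nat.le_succ n) (mk (maximalIdeal R ^ (n + 1)) (c * y)) = 0 :=
      eq_zero_iff_mem.2 hcy
    change factorPow (maximalIdeal R) (Nat.le_succ n) (1 + mk _ (c * y)) = 1
    rw [map_add, map_one, this, add_zero]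

/-- The units of the residue field of a complete local ring lift multiplicatively. -/
theorem exists_units_residue_section (R : Type*) [CommRing R] [IsLocalRing R]
    [IsAdicComplete (maximalIdeal R) R] :
    ∃ s : (ResidueField R)ˣ →* Rˣ, (Units.map (residue R).toMonoidHom).comp s =
      MonoidHom.id (ResidueField R)ˣ := by
  choose next hnext using fun (n : ℕ)
    (s : (ResidueField R)ˣ →* (R ⧸ maximalIdeal R ^ (n + 1))ˣ) ↦
      exists_units_lift_factorPow n.succ_pos s
  let t (n : ℕ) : (ResidueField R)ˣ →* (R ⧸ maximalIdeal R ^ (n + 1))ˣ :=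
    Nat.rec (Units.map (factor (pow_one (maximalIdeal R)).ge : ResidueField R →+* _).toMonoidHom)
      next n
  let f (n : ℕ) : MonoidAlgebra ℤ (ResidueField R)ˣ →+* R ⧸ maximalIdeal R ^ (n + 1) :=
    (MonoidAlgebra.lift ℤ _ _ ((Units.coeHom _).comp (t n))).toRingHom
  have hfof (n : ℕ) (a : (ResidueField R)ˣ) :
      f n (MonoidAlgebra.of ℤ _ a) = (t n a : R ⧸ maximalIdeal R ^ (n + 1)) :=
    MonoidAlgebra.lift_of _ a
  have ha : StrictMono fun n : ℕ ↦ n + 1 := fun _ _ h ↦ Nat.succ_lt_succ h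
  have hf {m : ℕ} : (factorPow (maximalIdeal R) (ha.monotone m.le_succ)).comp (f (m + 1)) = f m := by
    refine MonoidAlgebra.ringHom_ext (fun r ↦ ?_) fun a ↦ ?_
    · exact DFunLike.congr_fun (Subsingleton.elim
        (((factorPow (maximalIdeal R) (ha.monotone m.le_succ)).comp (f (m + 1))).comp
          MonoidAlgebra.singleOneRingHom) ((f m).comp MonoidAlgebra.singleOneRingHom)) r
    · refine (congrArg (factorPow (maximalIdeal R) (m + 1).le_succ) (hfof (m + 1) a)).trans ?_
      refine Eq.trans ?_ (hfof m a).symm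
      exact congrArg Units.val (DFunLike.congr_fun (hnext m (t m)) a)
  let F := IsAdicComplete.StrictMono.liftRingHom (maximalIdeal R) ha f hf
  refine ⟨((F : _ →* R).comp (MonoidAlgebra.of ℤ _)).toHomUnits, ?_⟩
  ext a
  have h0 : mk (maximalIdeal R ^ (0 + 1)) (F (MonoidAlgebra.of ℤ _ a)) = _ :=
    (IsAdicComplete.StrictMono.mk_liftRingHom (maximalIdeal R) ha f hf _).trans (hfof 0 a)
  change residue R (F (MonoidAlgebra.of ℤ _ a)) = a
  obtain ⟨r, hr⟩ := residue_surjective (a : ResidueField R)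
  have h1 : (t 0 a : R ⧸ maximalIdeal R ^ (0 + 1)) = mk (maximalIdeal R ^ (0 + 1)) r := by
    change factor (pow_one (maximalIdeal R)).ge (a : ResidueField R) = _
    rw [← hr]
    rfl
  rw [h1, Ideal.Quotient.eq, zero_add, pow_one] at h0
  rw [← hr]
  exact Ideal.Quotient.eq.2 h0

end IsLocalRing

/-- A section of a surjection of commutative groups splits it as a direct product. -/
def MonoidHom.mulEquivKerProdOfSection {G H : Type*} [CommGroup G] [CommGroup H] (f : G →* H)
    (s : H →* G) (hs : f.comp s = MonoidHom.id H) : G ≃* f.ker × H :=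
  have hs' (h : H) : f (s h) = h := DFunLike.congr_fun hs h
  { toFun u := (⟨u * (s (f u))⁻¹, by simp [MonoidHom.mem_ker, hs']⟩, f u)
    invFun x := x.1 * s x.2
    left_inv u := by simp
    right_inv x := by
      have h1 : f x.1 = 1 := x.1.2
      ext <;> simp [h1, hs']
    map_mul' u v := by
      refine Prod.ext (Subtype.ext ?_) (map_mul f u v)
      change u * v * (s (f (u * v)))⁻¹ = u * (s (f u))⁻¹ * (v * (s (f v))⁻¹)
      rw [map_mul, map_mul, mul_inv, mul_mul_mul_comm] }

/-- Let `(R, M, k)` be a complete local ring. The short exact sequence of abelian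
groups `1 → 1+M → Rˣ → kˣ → 1` is split: the map `Rˣ → kˣ` induced by the residue
map is surjective, its kernel is exactly the subgroup `1 + M` of `Rˣ`, it admits a
group-homomorphism section, and in particular `Rˣ ≅ (1+M) × kˣ` as abelian groups. -/
theorem stmt_3 (R : Type*) [CommRing R] [IsLocalRing R]
    [IsAdicComplete (IsLocalRing.maximalIdeal R) R] :
    Function.Surjective (Units.map (IsLocalRing.residue R).toMonoidHom) ∧
    (∀ u : Rˣ, u ∈ (Units.map (IsLocalRing.residue R).toMonoidHom).ker ↔
      ∃ x ∈ IsLocalRing.maximalIdeal R, (u : R) = 1 + x) ∧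
    (∃ s : (IsLocalRing.ResidueField R)ˣ →* Rˣ,
      (Units.map (IsLocalRing.residue R).toMonoidHom).comp s =
        MonoidHom.id (IsLocalRing.ResidueField R)ˣ) ∧
    Nonempty (Rˣ ≃* (Units.map (IsLocalRing.residue R).toMonoidHom).ker ×
      (IsLocalRing.ResidueField R)ˣ) := by
  obtain ⟨s, hs⟩ := IsLocalRing.exists_units_residue_section R
  refine ⟨fun a ↦ ⟨s a, DFunLike.congr_fun hs a⟩, fun u ↦ ?_, ⟨s, hs⟩,
    ⟨MonoidHom.mulEquivKerProdOfSection _ s hs⟩⟩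
  have key : u ∈ (Units.map (IsLocalRing.residue R).toMonoidHom).ker ↔
      (u : R) - 1 ∈ IsLocalRing.maximalIdeal R := by
    rw [MonoidHom.mem_ker, Units.ext_iff, ← IsLocalRing.residue_eq_zero_iff, map_sub, map_one,
      sub_eq_zero]
    rfl
  rw [key]
  constructor
  · exact fun h ↦ ⟨_, h, by ring⟩
  · rintro ⟨x, hx, hu⟩
    rwa [hu, add_sub_cancel_left]
end

section
/- Let (R, M, k) be a local ring whose maximal ideal M is nilpotent (in particular, any Artinian local ring). Then the short exact sequence of abelian groups 1 → 1+M → R* → k* → 1 is split, and hence R* ≅ (1+M) × k* as abelian groups. -/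
namespace AddMonoidHom

variable {A G : Type*} [AddCommGroup A] [AddCommGroup G]

/-- A surjection of abelian groups with divisible kernel splits. -/
theorem exists_section_of_divisible_ker (f : A →+ G) (hf : Function.Surjective f)
    (hdiv : ∀ n : ℕ, n ≠ 0 → ∀ b ∈ f.ker, ∃ c ∈ f.ker, n • c = b) :
    ∃ s : G →+ A, f.comp s = AddMonoidHom.id G := by
  let : DivisibleBy f.ker ℕ := divisibleByOfSMulRightSurj _ _ fun {n} hn b ↦ by
    obtain ⟨c, hc, h⟩ := hdiv n hn b b.2
    exact ⟨⟨c, hc⟩, Subtype.ext h⟩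
  let : DivisibleBy f.ker ℤ := AddGroup.divisibleByIntOfDivisibleByNat _
  obtain ⟨r, hr⟩ := (Module.Baer.of_divisible f.ker).extension_property_addMonoidHom
    f.ker.subtype f.ker.subtype_injective (AddMonoidHom.id _)
  have hker : ∀ a, f a = 0 → (r a : A) = a := fun a ha ↦
    congrArg Subtype.val (DFunLike.congr_fun hr ⟨a, ha⟩)
  let q : A →+ A := AddMonoidHom.id A - f.ker.subtype.comp r
  have hq : f.ker ≤ q.ker := fun a ha ↦ by
    simp [q, AddMonoidHom.mem_ker, hker a ha]
  refine ⟨f.liftOfSurjective hf ⟨q, hq⟩, ?_⟩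
  ext g
  obtain ⟨a, rfl⟩ := hf g
  have hra : f (r a) = 0 := (r a).2
  simp [q, hra, AddMonoidHom.liftOfRightInverse_comp_apply]

/-- Every subgroup of an elementary abelian `p`-group has a complement. -/
theorem _root_.AddSubgroup.exists_isCompl_of_zmodModule (p : ℕ) [Fact p.Prime]
    [Module (ZMod p) A] (B : AddSubgroup A) : ∃ C : AddSubgroup A, IsCompl B C := by
  obtain ⟨W, hW⟩ := Submodule.exists_isCompl (AddSubgroup.toZModSubmodule p B)
  exact ⟨(AddSubgroup.toZModSubmodule p).symm W,
    (AddSubgroup.toZModSubmodule p).isCompl_iff.2 (by simpa using hW)⟩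

/-- Modulo `pA`, every subgroup of an abelian group `A` has a complement. -/
theorem _root_.AddSubgroup.exists_sup_eq_top_inf_le_range_nsmul (p : ℕ) [Fact p.Prime]
    (B : AddSubgroup A) :
    ∃ C : AddSubgroup A, B ⊔ C = ⊤ ∧ ∀ a ∈ B ⊓ C, ∃ b, p • b = a := by
  let P : AddSubgroup A := (nsmulAddMonoidHom p : A →+ A).range
  let : Module (ZMod p) (A ⧸ P) := QuotientAddGroup.zmodModule fun x ↦ ⟨x, rfl⟩
  let π := QuotientAddGroup.mk' P
  obtain ⟨W, hW⟩ := (B.map π).exists_isCompl_of_zmodModule p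
  refine ⟨W.comap π, ?_, ?_⟩
  · refine eq_top_iff.2 fun a _ ↦ ?_
    have ha : π a ∈ B.map π ⊔ W := hW.sup_eq_top ▸ trivial
    obtain ⟨_, ⟨b, hb, rfl⟩, w, hw, h⟩ := AddSubgroup.mem_sup.1 ha
    refine AddSubgroup.mem_sup.2 ⟨b, hb, a - b, ?_, by abel⟩
    have : π (a - b) = w := by rw [map_sub, ← h]; abel
    simpa [this] using hw
  · rintro a ⟨hB, hC⟩
    have : π a = 0 := AddSubgroup.disjoint_def.1 hW.disjoint ⟨a, hB, rfl⟩ hC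
    exact (QuotientAddGroup.eq_zero_iff a).1 this

/-- A surjection of abelian groups splits if its kernel is killed by a power of a prime `p` and its
target has no `p`-torsion. -/
theorem exists_section_of_ker_nsmul_eq_zero (p : ℕ) [Fact p.Prime]
    (hG : ∀ g : G, p • g = 0 → g = 0) (n : ℕ) {A : Type*} [AddCommGroup A] (f : A →+ G)
    (hf : Function.Surjective f) (hn : ∀ a ∈ f.ker, p ^ n • a = 0) :
    ∃ s : G →+ A, f.comp s = AddMonoidHom.id G := by
  induction n generalizing A with
  | zero =>
    have hinj : Function.Injective f := (injective_iff_map_eq_zero f).2 fun a ha ↦ by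
      simpa using hn a ha
    exact ⟨(AddEquiv.ofBijective f ⟨hinj, hf⟩).symm, by
      ext g; exact (AddEquiv.ofBijective f ⟨hinj, hf⟩).apply_symm_apply g⟩
  | succ n ih =>
    obtain ⟨C, hsup, hinf⟩ := f.ker.exists_sup_eq_top_inf_le_range_nsmul p
    obtain ⟨s, hs⟩ := ih (f.comp C.subtype) (fun g ↦ by
      obtain ⟨a, rfl⟩ := hf g
      obtain ⟨b, hb, c, hc, rfl⟩ := AddSubgroup.mem_sup.1 (hsup ▸ AddSubgroup.mem_top a)
      exact ⟨⟨c, hc⟩, by simp [AddMonoidHom.mem_ker.1 hb]⟩) (fun c hc ↦ by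
      obtain ⟨b, hb⟩ := hinf c ⟨hc, c.2⟩
      have hfb : f b = 0 := hG _ (by rw [← map_nsmul, hb]; exact hc)
      ext
      simpa [← hb, pow_succ, mul_nsmul'] using hn b hfb)
    exact ⟨C.subtype.comp s, hs⟩

end AddMonoidHom

/-- A split surjection of commutative groups decomposes its source as a product. -/
theorem MonoidHom.nonempty_mulEquiv_ker_prod {A G : Type*} [CommGroup A] [Group G]
    (f : A →* G) (s : G →* A) (hs : f.comp s = MonoidHom.id G) : Nonempty (A ≃* f.ker × G) := by
  have hfs : ∀ g, f (s g) = g := DFunLike.congr_fun hs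
  exact ⟨MulEquiv.symm
    { toFun := fun x ↦ x.1 * s x.2
      invFun := fun a ↦ (⟨a * (s (f a))⁻¹, by simp [MonoidHom.mem_ker, hfs]⟩, f a)
      left_inv := fun ⟨⟨b, hb⟩, g⟩ ↦ by
        have hb' : f b = 1 := hb
        simp [hfs, hb']
      right_inv := fun a ↦ by simp
      map_mul' := fun x y ↦ by simp [mul_mul_mul_comm] }⟩

/-- If `I` contains `p`, then `p ^ i`-th powers of elements of `1 + I` lie in `1 + I ^ (i + 1)`. -/
theorem Ideal.pow_prime_pow_sub_one_mem {R : Type*} [CommRing R] {I : Ideal R} {p : ℕ}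
    (hp : (p : R) ∈ I) {u : R} (hu : u - 1 ∈ I) (i : ℕ) : u ^ p ^ i - 1 ∈ I ^ (i + 1) := by
  induction i with
  | zero => simpa using hu
  | succ i ih =>
    rw [pow_succ p, pow_mul, ← geom_sum_mul, pow_succ' I]
    refine Ideal.mul_mem_mul ?_ ih
    have h1 : Ideal.Quotient.mk I u = 1 := (Ideal.Quotient.eq.2 hu).trans (map_one _)
    rw [← Ideal.Quotient.eq_zero_iff_mem] at hp ⊢
    simpa [h1] using hp

/-- If `n` is a unit, then a unipotent element has a unipotent `n`-th root. -/
theorem exists_pow_eq_of_isNilpotent_sub_one {R : Type*} [CommRing R] {n : ℕ}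
    (hn : IsUnit (n : R)) {u : R} (hu : IsNilpotent (u - 1)) :
    ∃ v, IsNilpotent (v - 1) ∧ v ^ n = u := by
  open Polynomial in
  obtain ⟨v, ⟨hv, hv'⟩, -⟩ := existsUnique_nilpotent_sub_and_aeval_eq_zero (R := R) (S := R)
    (P := X ^ n - C u) (x := 1)
    (by simpa using (isNilpotent_neg_iff.2 hu)) (by simpa [derivative_X_pow] using hn)
  exact ⟨v, by simpa using isNilpotent_neg_iff.2 hv, by simpa [sub_eq_zero] using hv'⟩

namespace IsLocalRing

variable {R : Type*} [CommRing R] [IsLocalRing R]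

theorem mem_ker_unitsMap_residue {u : Rˣ} :
    u ∈ (Units.map (residue R).toMonoidHom).ker ↔ (u : R) - 1 ∈ maximalIdeal R := by
  rw [MonoidHom.mem_ker, ← residue_eq_zero_iff, map_sub, map_one, sub_eq_zero, Units.ext_iff]
  rfl

theorem unitsMap_residue_surjective :
    Function.Surjective (Units.map (residue R).toMonoidHom) :=
  surjective_units_map_of_local_ringHom _ residue_surjective inferInstance

/-- If the maximal ideal of a local ring is nilpotent, then the reduction map on units splits. -/
theorem exists_section_unitsMap_residue (hM : IsNilpotent (maximalIdeal R)) :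
    ∃ s : (ResidueField R)ˣ →* Rˣ,
      (Units.map (residue R).toMonoidHom).comp s = MonoidHom.id (ResidueField R)ˣ := by
  let f := Units.map (residue R).toMonoidHom
  suffices ∃ s, f.toAdditive.comp s = AddMonoidHom.id (Additive (ResidueField R)ˣ) by
    obtain ⟨s, hs⟩ := this
    exact ⟨MonoidHom.toAdditive.symm s, MonoidHom.ext fun g ↦ DFunLike.congr_fun hs g⟩
  have hf : Function.Surjective f.toAdditive := unitsMap_residue_surjective
  obtain ⟨p, hp⟩ := CharP.exists (ResidueField R)
  obtain ⟨n, hn⟩ := hM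
  rcases CharP.char_is_prime_or_zero (ResidueField R) p with hprime | rfl
  · have : Fact p.Prime := ⟨hprime⟩
    have hpM : (p : R) ∈ maximalIdeal R := by
      rw [← residue_eq_zero_iff, map_natCast, CharP.cast_eq_zero]
    refine f.toAdditive.exists_section_of_ker_nsmul_eq_zero p (fun g hg ↦ ?_) n hf fun a ha ↦ ?_
    · have hg' : ((g.toMul : (ResidueField R)ˣ) : ResidueField R) ^ p = 1 :=
        congrArg Units.val (congrArg Additive.toMul hg)
      refine congrArg Additive.ofMul (Units.ext (frobenius_inj (ResidueField R) p ?_))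
      exact hg'.trans (one_pow p).symm
    · have h := Ideal.pow_le_pow_right n.le_succ
        (Ideal.pow_prime_pow_sub_one_mem hpM (mem_ker_unitsMap_residue.1 ha) n)
      rw [hn] at h
      exact congrArg Additive.ofMul (Units.ext (sub_eq_zero.1 h))
  · have := CharP.charP_to_charZero (ResidueField R)
    refine f.toAdditive.exists_section_of_divisible_ker hf fun m hm b hb ↦ ?_
    have hmR : IsUnit (m : R) := by
      rw [← residue_ne_zero_iff_isUnit, map_natCast]
      exact_mod_cast hm
    have hb' := mem_ker_unitsMap_residue.1 hb
    obtain ⟨v, hv, hvb⟩ := exists_pow_eq_of_isNilpotent_sub_one hmR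
      (u := (b.toMul : Rˣ)) ⟨n, by have := Ideal.pow_mem_pow hb' n; rwa [hn] at this⟩
    have hvu : IsUnit v := (isUnit_pow_iff hm).1 (hvb ▸ b.toMul.isUnit)
    exact ⟨Additive.ofMul hvu.unit,
      mem_ker_unitsMap_residue.2 ((mem_maximalIdeal _).2 fun h ↦ hv.not_isUnit h),
      congrArg Additive.ofMul (Units.ext hvb)⟩

end IsLocalRing


/-- Let `(R, M, k)` be a local ring whose maximal ideal `M` is nilpotent. Then the
short exact sequence of abelian groups `1 → 1+M → Rˣ → kˣ → 1` is split: the map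
`Rˣ → kˣ` induced by the residue map is surjective, its kernel is exactly the
subgroup `1 + M` of `Rˣ`, it admits a group-homomorphism section, and hence
`Rˣ ≅ (1+M) × kˣ` as abelian groups. -/
theorem stmt_4 (R : Type*) [CommRing R] [IsLocalRing R]
    (hM : ∃ n : ℕ, 1 ≤ n ∧ (IsLocalRing.maximalIdeal R) ^ n = ⊥) :
    Function.Surjective (Units.map (IsLocalRing.residue R).toMonoidHom) ∧
    (∀ u : Rˣ, u ∈ (Units.map (IsLocalRing.residue R).toMonoidHom).ker ↔
      ∃ x ∈ IsLocalRing.maximalIdeal R, (u : R) = 1 + x) ∧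
    (∃ s : (IsLocalRing.ResidueField R)ˣ →* Rˣ,
      (Units.map (IsLocalRing.residue R).toMonoidHom).comp s =
        MonoidHom.id (IsLocalRing.ResidueField R)ˣ) ∧
    Nonempty (Rˣ ≃* (Units.map (IsLocalRing.residue R).toMonoidHom).ker ×
      (IsLocalRing.ResidueField R)ˣ) := by
  obtain ⟨n, -, hn⟩ := hM
  obtain ⟨s, hs⟩ := IsLocalRing.exists_section_unitsMap_residue ⟨n, hn⟩
  refine ⟨IsLocalRing.unitsMap_residue_surjective, fun u ↦ ?_, ⟨s, hs⟩,
    MonoidHom.nonempty_mulEquiv_ker_prod _ s hs⟩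
  rw [IsLocalRing.mem_ker_unitsMap_residue]
  exact ⟨fun h ↦ ⟨_, h, by ring⟩, fun ⟨x, hx, h⟩ ↦ by simpa [h] using hx⟩
end

section
/- Let K/k be an algebraic extension of fields. Then K is a separable extension of k if and only if K is formally étale as a k-algebra. -/
universe u

open Polynomial IntermediateField

/-- A ring homomorphism out of the base of a formally smooth algebra `A`, lifting the structure map
along a surjection onto `A` with nilpotent kernel, extends to a section of that surjection. -/
theorem Algebra.FormallySmooth.exists_section {R A B : Type*} [CommRing R] [CommRing A]
    [Algebra R A] [CommRing B] [Algebra.FormallySmooth R A] (i : R →+* B) (g : B →+* A)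
    (hg : Function.Surjective g) (hker : IsNilpotent (RingHom.ker g))
    (hi : ∀ r, g (i r) = algebraMap R A r) :
    ∃ s : A →+* B, (∀ x, g (s x) = x) ∧ ∀ r, s (algebraMap R A r) = i r := by
  algebraize [i]
  let g' : B →ₐ[R] A := { g with commutes' := hi }
  let s : A →ₐ[R] B := Algebra.FormallySmooth.liftOfSurjective (AlgHom.id R A) g' hg hker
  exact ⟨s, fun x ↦ Algebra.FormallySmooth.liftOfSurjective_apply (AlgHom.id R A) g' hg hker x,
    fun r ↦ s.commutes r⟩

section CharP

variable {k : Type*} [Field k] (p : ℕ)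

theorem Subfield.aeval_X_pow_sub_C_pow {F : Subfield k} {b : k} (hb : b ^ p ∈ F) :
    aeval b (X ^ p - C (⟨b ^ p, hb⟩ : F)) = 0 := by
  simp only [map_sub, map_pow, aeval_X, aeval_C]
  exact sub_self _

variable [Fact p.Prime]

theorem Subfield.isIntegral_of_pow_mem {F : Subfield k} {b : k} (hb : b ^ p ∈ F) :
    IsIntegral F b :=
  .of_pow (Fact.out : p.Prime).pos (isIntegral_algebraMap (x := (⟨b ^ p, hb⟩ : F)))

variable [CharP k p]

theorem Subfield.minpoly_eq_X_pow_sub_C_of_notMem {F : Subfield k} {b : k} (hb : b ∉ F)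
    (hbp : b ^ p ∈ F) : minpoly F b = X ^ p - C ⟨b ^ p, hbp⟩ := by
  have hp := (Fact.out : p.Prime)
  refine (minpoly.eq_of_irreducible_of_monic (X_pow_sub_C_irreducible_of_prime hp ?_) ?_
    (monic_X_pow_sub_C _ hp.ne_zero)).symm
  · rintro c hc
    have hc' : (c : k) ^ p = b ^ p := congrArg Subtype.val hc
    have : (c : k) = b := frobenius_inj k p hc'
    exact hb (this ▸ c.2)
  · exact Subfield.aeval_X_pow_sub_C_pow p hbp

/-- A subfield maximal among those containing all `p`-th powers and avoiding `a`. -/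
theorem Subfield.exists_maximal_notMem_of_forall_pow_ne {a : k} (ha : ∀ c, c ^ p ≠ a) :
    ∃ F : Subfield k, Maximal (fun F : Subfield k ↦ (∀ c, c ^ p ∈ F) ∧ a ∉ F) F := by
  have hzorn := zorn_le_nonempty₀ {F : Subfield k | (∀ c, c ^ p ∈ F) ∧ a ∉ F}
    (fun S hS hc E hE ↦ ⟨sSup S, ⟨fun c ↦ ?_, fun h ↦ ?_⟩, fun _ ↦ le_sSup⟩)
    (frobenius k p).fieldRange ⟨fun c ↦ ⟨c, rfl⟩, fun ⟨c, hc⟩ ↦ ha c hc⟩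
  · obtain ⟨F, -, hF⟩ := hzorn
    exact ⟨F, hF⟩
  · exact le_sSup hE ((hS hE).1 c)
  · obtain ⟨E', hE', h'⟩ := (Subfield.mem_sSup_of_directedOn ⟨E, hE⟩ hc.directedOn).1 h
    exact (hS hE').2 h'

/-- If `a` is not a `p`-th power in a field of characteristic `p`, then the field is generated
by `a` over some subfield containing all `p`-th powers but not `a`. -/
theorem Subfield.exists_adjoin_simple_eq_top {a : k} (ha : ∀ c, c ^ p ≠ a) :
    ∃ F : Subfield k, (∀ c, c ^ p ∈ F) ∧ a ∉ F ∧ F⟮a⟯ = ⊤ := by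
  obtain ⟨F, ⟨hFp, haF⟩, hmax⟩ := Subfield.exists_maximal_notMem_of_forall_pow_ne p ha
  have hint (b : k) : IsIntegral F b := Subfield.isIntegral_of_pow_mem p (hFp b)
  have hfin {b : k} (hb : b ∉ F) : Module.finrank F F⟮b⟯ = p := by
    rw [adjoin.finrank (hint b), Subfield.minpoly_eq_X_pow_sub_C_of_notMem p hb (hFp b),
      natDegree_X_pow_sub_C]
  refine ⟨F, hFp, haF, eq_top_iff.2 fun b _ ↦ ?_⟩
  by_cases hb : b ∈ F
  · exact F⟮a⟯.algebraMap_mem ⟨b, hb⟩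
  have hle : F ≤ F⟮b⟯.toSubfield := fun c hc ↦ F⟮b⟯.algebraMap_mem ⟨c, hc⟩
  have hab : a ∈ F⟮b⟯ := by
    by_contra h
    exact hb (hmax ⟨fun c ↦ hle (hFp c), h⟩ hle (mem_adjoin_simple_self F b))
  have := adjoin.finiteDimensional (hint b)
  have heq : F⟮a⟯ = F⟮b⟯ := eq_of_le_of_finrank_eq (adjoin_simple_le_iff.2 hab)
    ((hfin haF).trans (hfin hb).symm)
  exact heq ▸ mem_adjoin_simple_self F b

/-- If `a` is not a `p`-th power in `k`, then the inclusion of `k` in an extension `K` has a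
first-order deformation moving `a`. -/
theorem exists_ringHom_dualNumber (K : Type*) [Field K] [Algebra k K] {a : k}
    (ha : ∀ c, c ^ p ≠ a) :
    ∃ φ : k →+* DualNumber K, (∀ c, (φ c).fst = algebraMap k K c) ∧ (φ a).snd = 1 := by
  obtain ⟨F, hFp, haF, htop⟩ := Subfield.exists_adjoin_simple_eq_top p ha
  have : CharP K p := charP_of_injective_algebraMap (algebraMap k K).injective p
  have hmin := Subfield.minpoly_eq_X_pow_sub_C_of_notMem p haF (hFp a)
  have hint : IsIntegral F a := Subfield.isIntegral_of_pow_mem p (hFp a)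
  let pb : PowerBasis F k := PowerBasis.ofAdjoinEqTop hint (by
    rw [← adjoin_simple_toSubalgebra_of_isAlgebraic hint.isAlgebraic, htop, top_toSubalgebra])
  have hgen : pb.gen = a := PowerBasis.ofAdjoinEqTop_gen _ _
  let y : DualNumber K := TrivSqZeroExt.inl (algebraMap k K a) + TrivSqZeroExt.inr 1
  have hy : aeval y (minpoly F pb.gen) = 0 := by
    rw [hgen, hmin]
    ext
    · simpa [y, TrivSqZeroExt.algebraMap_eq_inl', IsScalarTower.algebraMap_apply F k K] using
        congrArg (algebraMap k K) (Subfield.aeval_X_pow_sub_C_pow p (hFp a))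
    · simp [y, TrivSqZeroExt.algebraMap_eq_inl']
  let φ : k →ₐ[F] DualNumber K := pb.lift y hy
  have hφ : φ a = y := by rw [← hgen]; exact pb.lift_gen y hy
  refine ⟨φ, fun c ↦ ?_, by simp [hφ, y]⟩
  have h : (TrivSqZeroExt.fstHom F K K).comp φ = IsScalarTower.toAlgHom F k K :=
    pb.algHom_ext (by simp [hgen, hφ, y])
  exact DFunLike.congr_fun h c

/-- A formally smooth field extension of characteristic `p` creates no new `p`-th powers. -/
theorem Algebra.FormallySmooth.exists_pow_eq (K : Type*) [Field K] [Algebra k K]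
    [Algebra.FormallySmooth k K] {a : k} {x : K} (hx : x ^ p = algebraMap k K a) :
    ∃ c, c ^ p = a := by
  by_contra! ha
  obtain ⟨φ, hφ, hφa⟩ := exists_ringHom_dualNumber p K ha
  have : CharP K p := charP_of_injective_algebraMap (algebraMap k K).injective p
  obtain ⟨s, -, hs⟩ := Algebra.FormallySmooth.exists_section φ
    (TrivSqZeroExt.fstHom K K K : DualNumber K →+* K) TrivSqZeroExt.fst_surjective
    ⟨2, TrivSqZeroExt.kerIdeal_sq K K⟩ hφ
  have h := congrArg TrivSqZeroExt.snd (hs a)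
  rw [← hx, map_pow, hφa, TrivSqZeroExt.snd_pow] at h
  simp at h

end CharP

/-- A formally smooth purely inseparable extension is trivial. -/
theorem IsPurelyInseparable.surjective_algebraMap_of_formallySmooth (k K : Type*) [Field k]
    [Field K] [Algebra k K] [IsPurelyInseparable k K] [Algebra.FormallySmooth k K] :
    Function.Surjective (algebraMap k K) := by
  obtain ⟨q, hq⟩ := ExpChar.exists k
  intro x
  obtain ⟨n, hn⟩ := IsPurelyInseparable.pow_mem k q x
  cases hq with
  | zero => simpa using hn
  | prime hp =>
    have : Fact q.Prime := ⟨hp⟩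
    have : CharP K q := charP_of_injective_algebraMap (algebraMap k K).injective q
    induction n with
    | zero => simpa using hn
    | succ n ih =>
      obtain ⟨a, ha⟩ := hn
      obtain ⟨c, rfl⟩ := Algebra.FormallySmooth.exists_pow_eq q K (x := x ^ q ^ n)
        (by rw [ha, pow_succ, pow_mul])
      refine ih ⟨c, frobenius_inj K q ?_⟩
      simpa [frobenius_def, pow_succ, pow_mul] using ha

/-- An algebraic extension of fields `K/k` is separable if and only if `K` is
formally étale as a `k`-algebra. -/
theorem stmt_13 (k K : Type u) [Field k] [Field K] [Algebra k K]
    [Algebra.IsAlgebraic k K] :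
    Algebra.IsSeparable k K ↔ Algebra.FormallyEtale k K := by
  refine ⟨fun _ ↦ Algebra.FormallyEtale.of_isSeparable k K, fun _ ↦ ?_⟩
  have : Algebra.FormallyUnramified k (separableClosure k K) :=
    Algebra.FormallyUnramified.of_isSeparable k (separableClosure k K)
  have : Algebra.FormallyEtale (separableClosure k K) K :=
    Algebra.FormallyEtale.of_restrictScalars (R := k)
  refine (separableClosure.eq_top_iff k K).1 (eq_top_iff.2 fun x _ ↦ ?_)
  obtain ⟨y, rfl⟩ := IsPurelyInseparable.surjective_algebraMap_of_formallySmooth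
    (separableClosure k K) K x
  exact y.2
end

section
/- Let R be a commutative ring, M and N two R-modules, and r ∈ R an element that is regular on M (multiplication by r is injective on M) and satisfies rN = 0. If, for some d ≥ 0, either Ext_R^d(M/rM, N) = 0 or Ext_R^{d+1}(M/rM, N) = 0, then Ext_R^d(M, N) = 0. -/
universe u

open CategoryTheory

lemma CategoryTheory.ProjectiveResolution.subsingleton_ext_iff {R : Type*} [Ring R]
    {C : Type*} [Category* C] [Abelian C] [Linear R C] [EnoughProjectives C]
    {X : C} (P : ProjectiveResolution X) (Y : C) (n : ℕ) :
    Subsingleton (((Ext R C n).obj (Opposite.op X)).obj Y) ↔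
      ∀ f : P.complex.X n ⟶ Y, P.complex.d (n + 1) n ≫ f = 0 →
        ∃ g : P.complex.X ((ComplexShape.up ℕ).prev n) ⟶ Y,
          P.complex.d n ((ComplexShape.up ℕ).prev n) ≫ g = f := by
  rw [← ModuleCat.isZero_iff_subsingleton, (P.isoExt n Y).isZero_iff,
    ← HomologicalComplex.exactAt_iff_isZero_homology,
    HomologicalComplex.exactAt_iff' _ _ n (n + 1) rfl (by simp),
    ShortComplex.moduleCat_exact_iff]
  rfl

lemma CategoryTheory.ProjectiveResolution.subsingleton_abelianExt_iff {C : Type*} [Category* C]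
    [Abelian C] [HasExt C] {X : C} (P : ProjectiveResolution X) (Y : C) (n : ℕ) :
    Subsingleton (Abelian.Ext X Y n) ↔
      ∀ f : P.complex.X n ⟶ Y, P.complex.d (n + 1) n ≫ f = 0 →
        ∃ g : P.complex.X ((ComplexShape.up ℕ).prev n) ⟶ Y,
          P.complex.d n ((ComplexShape.up ℕ).prev n) ≫ g = f := by
  have h_zero (f : P.complex.X n ⟶ Y) (hf : P.complex.d (n + 1) n ≫ f = 0) :
      P.extMk f (n + 1) rfl hf = 0 ↔
        ∃ g : P.complex.X ((ComplexShape.up ℕ).prev n) ⟶ Y,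
          P.complex.d n ((ComplexShape.up ℕ).prev n) ≫ g = f := by
    cases n with
    | zero =>
      have hd : P.cochainComplex.d 0 1 = 0 :=
        (CochainComplex.isZero_of_isStrictlyLE P.cochainComplex 0 1).eq_of_tgt _ _
      simp only [← P.extEquivCohomologyClass.apply_eq_iff_eq,
        P.extEquivCohomologyClass_extMk, P.extEquivCohomologyClass_zero,
        CochainComplex.HomComplex.CohomologyClass.mk_eq_zero_iff]
      rw [CochainComplex.HomComplex.Cocycle.toSingleMk_mem_coboundaries_iff _ _ _ _ _ 1 (by simp)]
      simp [hd, eq_comm (a := (0 : P.cochainComplex.X 0 ⟶ Y)),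
        eq_comm (a := (0 : P.complex.X 0 ⟶ Y))]
    | succ p =>
      rw [P.extMk_eq_zero_iff f _ rfl hf p rfl, CochainComplex.prev_nat_succ]
  refine ⟨fun _ f hf => (h_zero f hf).1 (Subsingleton.elim _ _), fun h => ?_⟩
  refine subsingleton_of_forall_eq 0 fun α => ?_
  obtain ⟨f, hf, rfl⟩ := P.extMk_surjective α (n + 1) rfl
  exact (h_zero f hf).2 (h f hf)

lemma subsingleton_ext_iff_subsingleton_abelianExt (R : Type*) [Ring R] {C : Type*} [Category* C]
    [Abelian C] [Linear R C] [EnoughProjectives C] [HasExt C] (X Y : C) (n : ℕ) :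
    Subsingleton (((Ext R C n).obj (Opposite.op X)).obj Y) ↔
      Subsingleton (Abelian.Ext X Y n) :=
  ((projectiveResolution X).subsingleton_ext_iff Y n).trans
    ((projectiveResolution X).subsingleton_abelianExt_iff Y n).symm

lemma CategoryTheory.Abelian.Ext.mk₀_smul_id_comp_eq_zero {R : Type*} [CommRing R] {C : Type*}
    [Category* C] [Abelian C] [Linear R C] [HasExt C] {X Y : C} {r : R}
    (hr : r • 𝟙 Y = 0) {n : ℕ} (x : Abelian.Ext X Y n) :
    (Abelian.Ext.mk₀ (r • 𝟙 X)).comp x (zero_add n) = 0 := by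
  rw [Abelian.Ext.mk₀_smul, Abelian.Ext.smul_comp, Abelian.Ext.mk₀_id_comp,
    Abelian.Ext.smul_eq_comp_mk₀, hr, Abelian.Ext.mk₀_zero, Abelian.Ext.comp_zero]

lemma CategoryTheory.Abelian.Ext.subsingleton_of_shortExact_smul_id {R : Type*} [CommRing R]
    {C : Type*} [Category* C] [Abelian C] [Linear R C] [HasExt C] {X Y Z : C} {r : R}
    {g : X ⟶ Z} {w : (r • 𝟙 X) ≫ g = 0} (hS : (ShortComplex.mk (r • 𝟙 X) g w).ShortExact)
    (hr : r • 𝟙 Y = 0) {n : ℕ}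
    (h : Subsingleton (Abelian.Ext Z Y n) ∨ Subsingleton (Abelian.Ext Z Y (n + 1))) :
    Subsingleton (Abelian.Ext X Y n) := by
  refine subsingleton_of_forall_eq 0 fun x => ?_
  obtain h | h := h
  · obtain ⟨y, rfl⟩ := Abelian.Ext.contravariant_sequence_exact₂ hS _ x
      (mk₀_smul_id_comp_eq_zero hr x)
    rw [h.elim y 0, Abelian.Ext.comp_zero]
  · obtain ⟨y, rfl⟩ := Abelian.Ext.contravariant_sequence_exact₁ hS _ x (add_comm 1 n)
      (h.elim _ _)
    exact mk₀_smul_id_comp_eq_zero hr y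

/-- Let `R` be a commutative ring, `M`, `N` two `R`-modules, and `r ∈ R` regular on
`M` with `r • N = 0`. If `Ext_R^d (M/rM, N) = 0` or `Ext_R^{d+1} (M/rM, N) = 0` for
some `d ≥ 0`, then `Ext_R^d (M, N) = 0`. -/
theorem stmt_16 (R : Type u) [CommRing R] (M N : Type u)
    [AddCommGroup M] [Module R M] [AddCommGroup N] [Module R N]
    (r : R) (hreg : ∀ x : M, r • x = 0 → x = 0) (hN : ∀ y : N, r • y = 0)
    (d : ℕ)
    (h : Subsingleton
        (((Ext R (ModuleCat.{u} R) d).obj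
          (Opposite.op (ModuleCat.of R
            (M ⧸ ((Ideal.span {r} : Ideal R) • (⊤ : Submodule R M)))))).obj
          (ModuleCat.of R N)) ∨
      Subsingleton
        (((Ext R (ModuleCat.{u} R) (d + 1)).obj
          (Opposite.op (ModuleCat.of R
            (M ⧸ ((Ideal.span {r} : Ideal R) • (⊤ : Submodule R M)))))).obj
          (ModuleCat.of R N))) :
    Subsingleton
      (((Ext R (ModuleCat.{u} R) d).obj
        (Opposite.op (ModuleCat.of R M))).obj (ModuleCat.of R N)) := by
  rw [subsingleton_ext_iff_subsingleton_abelianExt,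
    subsingleton_ext_iff_subsingleton_abelianExt, Submodule.ideal_span_singleton_smul] at h
  rw [subsingleton_ext_iff_subsingleton_abelianExt]
  have reg : IsSMulRegular (ModuleCat.of R M) r :=
    (isSMulRegular_iff_right_eq_zero_of_smul).2 hreg
  have hS := reg.smulShortComplex_shortExact
  have hr : r • 𝟙 (ModuleCat.of R N) = 0 := by
    ext y
    exact hN y
  exact Abelian.Ext.subsingleton_of_shortExact_smul_id (R := R) (r := r) hS hr h
end

section
/- Let F be a perfect field and k any field extension of F. Then k is formally smooth as an F-algebra. -/
universe u

open MvPolynomial in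
/-- The class of a relation `x` is in the kernel of the cotangent complex iff all its partial
derivatives vanish in the target. -/
lemma Algebra.Generators.cotangentComplex_mk_eq_zero_iff {R S ι : Type*} [CommRing R] [CommRing S]
    [Algebra R S] (P : Algebra.Generators R S ι) (x : P.toExtension.ker) :
    P.toExtension.cotangentComplex (Algebra.Extension.Cotangent.mk x) = 0 ↔
      ∀ i, aeval P.val (pderiv i x.val) = 0 := by
  rw [Algebra.Extension.cotangentComplex_mk, ← P.cotangentSpaceBasis.repr.map_eq_zero_iff,
    Finsupp.ext_iff]
  exact forall_congr' fun i ↦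
    Eq.congr (P.cotangentSpaceBasis_repr_one_tmul x.val i) Finsupp.zero_apply

open MvPolynomial in
/-- If every finitely generated subextension is formally smooth, then so is the whole field
extension. -/
lemma Algebra.FormallySmooth.of_forall_adjoin_finset {F k : Type*} [Field F] [Field k] [Algebra F k]
    (H : ∀ s : Finset k, Algebra.FormallySmooth F (IntermediateField.adjoin F (s : Set k))) :
    Algebra.FormallySmooth F k := by
  refine ⟨inferInstance, ?_⟩
  rw [Algebra.Extension.subsingleton_h1Cotangent, injective_iff_map_eq_zero]
  intro x hx
  obtain ⟨⟨p, hp⟩, rfl⟩ := Algebra.Extension.Cotangent.mk_surjective x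
  replace hx := ((Algebra.Generators.self F k).cotangentComplex_mk_eq_zero_iff ⟨p, hp⟩).mp hx
  obtain ⟨L, _, q, rfl⟩ : ∃ L : IntermediateField F k, Algebra.FormallySmooth F L ∧
      ∃ q : MvPolynomial L F, rename (algebraMap L k) q = p :=
    ⟨_, H (vars (σ := k) p), exists_rename_eq_of_vars_subset_range (σ := k) p _
      (FaithfulSMul.algebraMap_injective _ k) fun a ha ↦
        ⟨⟨a, IntermediateField.subset_adjoin F _ ha⟩, rfl⟩⟩
  have aeval_rename_eq (r : MvPolynomial L F) :
      aeval _root_.id (rename (algebraMap L k) r) = algebraMap L k (aeval _root_.id r) := by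
    rw [aeval_rename, ← aeval_algebraMap_apply]
    rfl
  let Q := Algebra.Generators.self F L
  let f : Q.Hom (Algebra.Generators.self F k) :=
    { val := fun i ↦ X (algebraMap L k i)
      aeval_val := fun i ↦ aeval_X _ _ }
  have hq : q ∈ Q.ker := by
    rw [Algebra.Generators.ker_eq_ker_aeval_val]
    exact (algebraMap L k).injective ((aeval_rename_eq q).symm.trans
      ((Algebra.Generators.aeval_val_eq_zero hp).trans (map_zero _).symm))
  have hmk : Algebra.Extension.Cotangent.mk (⟨q, hq⟩ : Q.toExtension.ker) = 0 := by
    refine (injective_iff_map_eq_zero _).mp (Q.toExtension.subsingleton_h1Cotangent.mp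
      Algebra.FormallySmooth.subsingleton_h1Cotangent) _ ?_
    refine (Q.cotangentComplex_mk_eq_zero_iff ⟨q, hq⟩).mpr fun i ↦ ?_
    have hi := hx (algebraMap L k i)
    dsimp only at hi
    rw [pderiv_rename (algebraMap L k).injective] at hi
    exact (algebraMap L k).injective
      ((aeval_rename_eq _).symm.trans (hi.trans (map_zero _).symm))
  have hmap := Algebra.Extension.Cotangent.map_mk f.toExtensionHom ⟨q, hq⟩
  rw [hmk, map_zero] at hmap
  have hfq : f.toExtensionHom.toAlgHom q = rename (algebraMap L k) q :=
    (DFunLike.congr_fun (rename_eq_aeval (algebraMap L k)) q).symm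
  simp only [hfq] at hmap
  exact hmap.symm

/-- Every field extension `k` of a perfect field `F` is formally smooth as an
`F`-algebra. -/
theorem stmt_18 (F k : Type u) [Field F] [PerfectField F] [Field k] [Algebra F k] :
    Algebra.FormallySmooth F k := by
  refine .of_forall_adjoin_finset fun s ↦ ?_
  have : Algebra.EssFiniteType F (IntermediateField.adjoin F (s : Set k)) :=
    IntermediateField.essFiniteType_iff.mpr ⟨s, rfl⟩
  infer_instance
end
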